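/- Let γ₁, γ₂, γ₃ be distinct negative reals, δγ := (γ₂−γ₁)(γ₃−γ₂)(γ₃−γ₁), and let G(t,s) := g₁(t,s)/δγ where g₁(t,s) = 0 for t ≥ s and g₁(t,s) = (γ₃−γ₂)e^{−γ₁(t−s)} + (γ₁−γ₃)e^{−γ₂(t−s)} + (γ₂−γ₁)e^{−γ₃(t−s)} for t ≤ s. Let Λ₁, Λ₂ : [t₀,∞) → ℝ³ be continuous, C ∈ ℝ⁷, Ω : [t₀,∞) → ℝ continuous, F(t,x₁,x₂,x₃) := Λ₁(t)·(x₁,x₂,x₃) + Λ₂(t)·(x₁x₂,x₁²,x₁³) + C·(x₂²,x₁x₂,x₁x₃,x₁²,x₁²x₂,x₁³,x₁⁴), and (Tw)(t) := ∫_{t₀}^∞ G(t,s)(Ω(s) + F(s,w(s),w′(s),w″(s))) ds. Set L(E)(t) := ∫_{t₀}^∞ (|G(t,s)| + |∂G/∂t(t,s)| + |∂²G/∂t²(t,s)|)|E(s)| ds (the t-derivatives taken for s ≠ t) and assume L(‖Λ₁‖₁)(t), L(‖Λ₂‖₁)(t) and L(1)(t) are finite for all t. Then for every η ∈ (0,1/2)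 and all twice continuously differentiable z, w : [t₀,∞) → ℝ with sup_t(|z|+|z′|+|z″|) ≤ η and sup_t(|w|+|w′|+|w″|) ≤ η, and for all t ≥ t₀: Σ_{j=0}^{2}|(Tz)^{(j)}(t) − (Tw)^{(j)}(t)| ≤ ‖z−w‖₀·(L(‖Λ₁‖₁)(t) + 2η·L(‖Λ₂‖₁)(t) + 2η·‖C‖₁·L(1)(t)), where ‖z−w‖₀ := sup_{t ≥ t₀} Σ_{j=0}^{2}|z^{(j)}(t) − w^{(j)}(t)|. -/

import Mathlib

open Set MeasureTheory Filter Topology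

/-- The Green kernel `g₁/δγ` (case of three negative characteristic roots). -/
noncomputable def g1Green (g1 g2 g3 : ℝ) (t s : ℝ) : ℝ :=
  if t < s then
    ((g2 - g1) * (g3 - g2) * (g3 - g1))⁻¹ *
      ((g3 - g2) * Real.exp (-(g1 * (t - s))) + (g1 - g3) * Real.exp (-(g2 * (t - s)))
        + (g2 - g1) * Real.exp (-(g3 * (t - s))))
  else 0

/-- The nonlinearity `F = F̂₁ + F̂₂ + Γ`. -/
noncomputable def Fnl (L1 L2 : ℝ → Fin 3 → ℝ) (C : Fin 7 → ℝ) (t x1 x2 x3 : ℝ) : ℝ :=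
  L1 t 0 * x1 + L1 t 1 * x2 + L1 t 2 * x3
    + L2 t 0 * (x1 * x2) + L2 t 1 * x1 ^ 2 + L2 t 2 * x1 ^ 3
    + C 0 * x2 ^ 2 + C 1 * (x1 * x2) + C 2 * (x1 * x3) + C 3 * x1 ^ 2
    + C 4 * (x1 ^ 2 * x2) + C 5 * x1 ^ 3 + C 6 * x1 ^ 4

/-- The exponential sum `u ↦ ∑ i, c i * exp (r i * u)`. -/
noncomputable def expSum {ι : Type*} [Fintype ι] (c r : ι → ℝ) (u : ℝ) : ℝ :=
  ∑ i, c i * Real.exp (r i * u)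

/-- The exponential sum cut off to the negative half-line. -/
noncomputable def truncExpSum {ι : Type*} [Fintype ι] (c r : ι → ℝ) (u : ℝ) : ℝ :=
  if u < 0 then expSum c r u else 0

section ExpSum

variable {ι : Type*} [Fintype ι] {c r : ι → ℝ} {p : ℝ}

lemma hasDerivAt_expSum (c r : ι → ℝ) (u : ℝ) :
    HasDerivAt (expSum c r) (expSum (c * r) r u) u := by
  unfold expSum
  refine HasDerivAt.fun_sum fun i _ => ?_
  have h := (((hasDerivAt_id u).const_mul (r i)).exp).const_mul (c i)
  refine h.congr_deriv ?_
  simp only [Pi.mul_apply, id]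
  ring

lemma abs_expSum_le (hr : ∀ i, p ≤ r i) {u : ℝ} (hu : u ≤ 0) :
    |expSum c r u| ≤ (∑ i, |c i|) * Real.exp (p * u) := by
  unfold expSum
  refine (Finset.abs_sum_le_sum_abs _ _).trans ?_
  rw [Finset.sum_mul]
  refine Finset.sum_le_sum fun i _ => ?_
  rw [abs_mul, Real.abs_exp]
  exact mul_le_mul_of_nonneg_left
    (Real.exp_le_exp.2 (mul_le_mul_of_nonpos_right (hr i) hu)) (abs_nonneg _)

lemma abs_truncExpSum_le (hr : ∀ i, p ≤ r i) (u : ℝ) :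
    |truncExpSum c r u| ≤ (∑ i, |c i|) * Real.exp (p * u) := by
  unfold truncExpSum
  split_ifs with h
  · exact abs_expSum_le hr h.le
  · simp only [abs_zero]
    positivity

lemma measurable_truncExpSum (c r : ι → ℝ) : Measurable (truncExpSum c r) := by
  unfold truncExpSum
  refine Measurable.ite measurableSet_Iio ?_ measurable_const
  exact (continuous_iff_continuousAt.2 fun u => (hasDerivAt_expSum c r u).continuousAt).measurable

lemma hasDerivAt_truncExpSum (c r : ι → ℝ) {u : ℝ} (hu : u ≠ 0) :
    HasDerivAt (truncExpSum c r) (truncExpSum (c * r) r u) u := by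
  rcases lt_or_gt_of_ne hu with h | h
  · have : truncExpSum c r =ᶠ[𝓝 u] expSum c r := by
      filter_upwards [Iio_mem_nhds h] with v hv
      exact if_pos hv
    rw [truncExpSum, if_pos h]
    exact (hasDerivAt_expSum c r u).congr_of_eventuallyEq this
  · have : truncExpSum c r =ᶠ[𝓝 u] fun _ => 0 := by
      filter_upwards [Ioi_mem_nhds h] with v hv
      exact if_neg (not_lt.2 (le_of_lt hv))
    rw [truncExpSum, if_neg (not_lt.2 h.le)]
    exact (hasDerivAt_const u 0).congr_of_eventuallyEq this

lemma truncExpSum_eq (hc : ∑ i, c i = 0) (u : ℝ) :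
    truncExpSum c r u = expSum c r (min u 0) := by
  unfold truncExpSum
  split_ifs with h
  · rw [min_eq_left h.le]
  · rw [min_eq_right (not_lt.1 h)]
    simp [expSum, hc]

lemma abs_truncExpSum_sub_le (hp : 0 ≤ p) (hr : ∀ i, p ≤ r i) (hc : ∑ i, c i = 0)
    {u v b : ℝ} (hu : u ≤ b) (hv : v ≤ b) :
    |truncExpSum c r u - truncExpSum c r v|
      ≤ (∑ i, |(c * r) i|) * Real.exp (p * b) * |u - v| := by
  rw [truncExpSum_eq hc, truncExpSum_eq hc]
  have key := Convex.norm_image_sub_le_of_norm_hasDerivWithin_le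
    (f := expSum c r) (f' := expSum (c * r) r) (s := Iic (min b 0))
    (C := (∑ i, |(c * r) i|) * Real.exp (p * b)) (x := min v 0) (y := min u 0)
    (fun x _ => (hasDerivAt_expSum c r x).hasDerivWithinAt)
    (fun x hx => by
      have hx : x ≤ min b 0 := hx
      refine (abs_expSum_le hr (hx.trans (min_le_right _ _))).trans ?_
      gcongr
      exact hx.trans (min_le_left _ _))
    (convex_Iic _) (min_le_min_right _ hv) (min_le_min_right _ hu)
  refine key.trans ?_
  gcongr
  rw [Real.norm_eq_abs]
  simpa using abs_min_sub_min_le_max u 0 v 0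

lemma integrable_truncExpSum_mul {E : ℝ → ℝ} {μ : Measure ℝ} (hr : ∀ i, p ≤ r i)
    (hE : AEStronglyMeasurable E μ) (hEint : Integrable (fun s => Real.exp (-(p * s)) * E s) μ)
    (t : ℝ) : Integrable (fun s => truncExpSum c r (t - s) * E s) μ := by
  refine (hEint.norm.const_mul ((∑ i, |c i|) * Real.exp (p * t))).mono' ?_ ?_
  · exact (((measurable_truncExpSum c r).comp
      (measurable_const.sub measurable_id)).aestronglyMeasurable).mul hE
  · refine Eventually.of_forall fun s => ?_
    rw [norm_mul, norm_mul, Real.norm_eq_abs, Real.norm_eq_abs (Real.exp _), Real.abs_exp]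
    have h := abs_truncExpSum_le (c := c) hr (t - s)
    calc _ ≤ (∑ i, |c i|) * Real.exp (p * (t - s)) * ‖E s‖ := by gcongr
      _ = _ := by
        rw [show p * (t - s) = p * t + -(p * s) by ring, Real.exp_add]
        ring

lemma hasDerivAt_integral_truncExpSum {E : ℝ → ℝ} {S : Set ℝ} (hp : 0 ≤ p)
    (hr : ∀ i, p ≤ r i) (hc : ∑ i, c i = 0)
    (hE : AEStronglyMeasurable E (volume.restrict S))
    (hEint : IntegrableOn (fun s => Real.exp (-(p * s)) * E s) S) (t : ℝ) :
    HasDerivAt (fun t => ∫ s in S, truncExpSum c r (t - s) * E s)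
      (∫ s in S, truncExpSum (c * r) r (t - s) * E s) t := by
  have hne : ∀ᵐ s ∂(volume.restrict S), s ≠ t :=
    ae_restrict_of_ae (Measure.ae_ne volume t)
  refine (hasDerivAt_integral_of_dominated_loc_of_lip (Metric.ball_mem_nhds t one_pos)
    (F := fun t s => truncExpSum c r (t - s) * E s)
    (bound := fun s => (∑ i, |(c * r) i|) * Real.exp (p * (t + 1)) *
      ‖Real.exp (-(p * s)) * E s‖)
    (Eventually.of_forall fun x => (integrable_truncExpSum_mul hr hE hEint x).aestronglyMeasurable)
    (integrable_truncExpSum_mul hr hE hEint t)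
    (integrable_truncExpSum_mul hr hE hEint t).aestronglyMeasurable
    (Eventually.of_forall fun s => ?_) (hEint.norm.const_mul _) ?_).2
  · refine LipschitzOnWith.of_dist_le_mul fun x hx y hy => ?_
    have hx' : x - s ≤ t + 1 - s := by
      have := (abs_lt.1 (show |x - t| < 1 from hx)).2
      linarith
    have hy' : y - s ≤ t + 1 - s := by
      have := (abs_lt.1 (show |y - t| < 1 from hy)).2
      linarith
    have h := abs_truncExpSum_sub_le hp hr hc hx' hy'
    rw [Real.dist_eq, Real.dist_eq, ← sub_mul, abs_mul, Real.coe_nnabs, abs_mul, abs_norm,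
      abs_of_nonneg (show 0 ≤ (∑ i, |(c * r) i|) * Real.exp (p * (t + 1)) by positivity),
      norm_mul, Real.norm_eq_abs, Real.norm_eq_abs, Real.abs_exp]
    calc _ ≤ (∑ i, |(c * r) i|) * Real.exp (p * (t + 1 - s)) * |x - s - (y - s)| * |E s| :=
          mul_le_mul_of_nonneg_right h (abs_nonneg _)
      _ = _ := by
        rw [show p * (t + 1 - s) = p * (t + 1) + -(p * s) by ring, Real.exp_add,
          show x - s - (y - s) = x - y by ring]
        ring
  · filter_upwards [hne] with s hs
    have h := (hasDerivAt_truncExpSum c r (sub_ne_zero.2 hs.symm)).comp_sub_const t s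
    exact h.mul_const _

lemma isBigO_exp_truncExpSum {i₀ : ι} (hr : ∀ i, i ≠ i₀ → r i₀ < r i) (hc : c i₀ ≠ 0) (t : ℝ) :
    (fun s => Real.exp (-(r i₀ * s))) =O[atTop] fun s => truncExpSum c r (t - s) := by
  classical
  have hlim : Tendsto (fun s => truncExpSum c r (t - s) * Real.exp (r i₀ * s)) atTop
      (𝓝 (c i₀ * Real.exp (r i₀ * t))) := by
    have h1 : Tendsto (fun s => ∑ i, c i * Real.exp (r i * t) * Real.exp (-((r i - r i₀) * s)))
        atTop (𝓝 (∑ i, if i = i₀ then c i₀ * Real.exp (r i₀ * t) else 0)) := by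
      refine tendsto_finsetSum _ fun i _ => ?_
      split_ifs with h
      · subst h
        simp
      · have : Tendsto (fun s => Real.exp (-((r i - r i₀) * s))) atTop (𝓝 0) :=
          Real.tendsto_exp_neg_atTop_nhds_zero.comp
            (tendsto_id.const_mul_atTop (sub_pos.2 (hr i h)))
        simpa using this.const_mul (c i * Real.exp (r i * t))
    rw [Finset.sum_ite_eq' Finset.univ i₀, if_pos (Finset.mem_univ _)] at h1
    refine h1.congr' ?_
    filter_upwards [eventually_gt_atTop t] with s hs
    rw [truncExpSum, if_pos (sub_neg.2 hs), expSum, Finset.sum_mul]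
    refine Finset.sum_congr rfl fun i _ => ?_
    rw [mul_assoc, mul_assoc, ← Real.exp_add, ← Real.exp_add]
    ring_nf
  have hinv := (hlim.inv₀ (mul_ne_zero hc (Real.exp_pos _).ne')).isBigO_one ℝ
  have hne := hlim.eventually_ne (mul_ne_zero hc (Real.exp_pos _).ne')
  have h := hinv.mul (Asymptotics.isBigO_refl (fun s => truncExpSum c r (t - s)) atTop)
  refine (h.congr' ?_ ?_)
  · filter_upwards [hne] with s hs
    have := left_ne_zero_of_mul hs
    rw [Real.exp_neg]
    field_simp
  · exact Eventually.of_forall fun s => one_mul _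

lemma integrableOn_exp_mul_of_truncExpSum_mul {E : ℝ → ℝ} {a : ℝ} {i₀ : ι}
    (hr : ∀ i, i ≠ i₀ → r i₀ < r i) (hc : c i₀ ≠ 0) (hE : ContinuousOn E (Ici a)) (t : ℝ)
    (hEint : IntegrableOn (fun s => truncExpSum c r (t - s) * E s) (Ioi a)) :
    IntegrableOn (fun s => Real.exp (-(r i₀ * s)) * E s) (Ioi a) := by
  refine IntegrableOn.mono_set ?_ Ioi_subset_Ici_self
  refine LocallyIntegrableOn.integrableOn_of_isBigO_atTop
    (g := fun s => truncExpSum c r (t - s) * E s) ?_ ?_ ⟨Ioi a, Ioi_mem_atTop a, hEint⟩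
  · refine ContinuousOn.locallyIntegrableOn ?_ measurableSet_Ici
    exact ContinuousOn.mul (by fun_prop) hE
  · exact (isBigO_exp_truncExpSum hr hc t).mul (Asymptotics.isBigO_refl _ _)

end ExpSum

lemma g1Green_eq_truncExpSum (g1 g2 g3 t s : ℝ) :
    g1Green g1 g2 g3 t s = truncExpSum
      (fun i => ((g2 - g1) * (g3 - g2) * (g3 - g1))⁻¹ * ![g3 - g2, g1 - g3, g2 - g1] i)
      ![-g1, -g2, -g3] (t - s) := by
  simp only [g1Green, truncExpSum, expSum, sub_neg, Fin.sum_univ_three, Matrix.cons_val,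
    neg_mul]
  congr 1
  ring

lemma abs_monomial_diffs_le {η D x1 x2 x3 y1 y2 y3 : ℝ} (hη0 : 0 < η) (hη1 : η < 1 / 2)
    (hx : |x1| + |x2| + |x3| ≤ η) (hy : |y1| + |y2| + |y3| ≤ η)
    (hD : |x1 - y1| + |x2 - y2| + |x3 - y3| ≤ D) :
    |x1 * x2 - y1 * y2| ≤ 2 * η * D ∧ |x1 * x3 - y1 * y3| ≤ 2 * η * D ∧
    |x1 ^ 2 - y1 ^ 2| ≤ 2 * η * D ∧ |x2 ^ 2 - y2 ^ 2| ≤ 2 * η * D ∧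
    |x1 ^ 3 - y1 ^ 3| ≤ 2 * η * D ∧ |x1 ^ 2 * x2 - y1 ^ 2 * y2| ≤ 2 * η * D ∧
    |x1 ^ 4 - y1 ^ 4| ≤ 2 * η * D := by
  have a1 := abs_nonneg (x1 - y1)
  have a2 := abs_nonneg (x2 - y2)
  have a3 := abs_nonneg (x3 - y3)
  have b1 := abs_nonneg x1
  have b2 := abs_nonneg x2
  have b3 := abs_nonneg x3
  have c1 := abs_nonneg y1
  have c2 := abs_nonneg y2
  have c3 := abs_nonneg y3
  have hD0 : 0 ≤ D := by linarith
  have hx1 : |x1| ≤ η := by linarith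
  have hx2 : |x2| ≤ η := by linarith
  have hx3 : |x3| ≤ η := by linarith
  have hy1 : |y1| ≤ η := by linarith
  have hy2 : |y2| ≤ η := by linarith
  have d1 : |x1 - y1| ≤ D := by linarith
  have d2 : |x2 - y2| ≤ D := by linarith
  have d3 : |x3 - y3| ≤ D := by linarith
  have e : ∀ {u v u₁ v₁ : ℝ}, |u - u₁| ≤ D → |v - v₁| ≤ D → |v| ≤ η → |u₁| ≤ η →
      |u * v - u₁ * v₁| ≤ 2 * η * D := by
    intro u v u₁ v₁ h1 h2 h3 h4
    calc |u * v - u₁ * v₁| = |(u - u₁) * v + u₁ * (v - v₁)| := by ring_nf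
      _ ≤ |u - u₁| * |v| + |u₁| * |v - v₁| := by
        rw [← abs_mul, ← abs_mul]
        exact abs_add_le _ _
      _ ≤ D * η + η * D := by gcongr
      _ = 2 * η * D := by ring
  have hηD : 2 * η * D ≤ D := by nlinarith
  have hsq : |y1 ^ 2| ≤ η := by
    rw [abs_pow]
    nlinarith
  have hcu : |y1 ^ 3| ≤ η := by
    rw [pow_succ, abs_mul]
    nlinarith [abs_nonneg (y1 ^ 2)]
  have q1 : |x1 ^ 2 - y1 ^ 2| ≤ 2 * η * D := by simpa only [sq] using e d1 d1 hx1 hy1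
  have q2 : |x2 ^ 2 - y2 ^ 2| ≤ 2 * η * D := by simpa only [sq] using e d2 d2 hx2 hy2
  have t1 : |x1 ^ 3 - y1 ^ 3| ≤ 2 * η * D := by
    simpa only [← pow_succ] using e (q1.trans hηD) d1 hx1 hsq
  refine ⟨e d1 d2 hx2 hy1, e d1 d3 hx3 hy1, q1, q2, t1, e (q1.trans hηD) d2 hx2 hsq, ?_⟩
  simpa only [← pow_succ] using e (t1.trans hηD) d1 hx1 hcu

lemma abs_Fnl_sub_le (L1 L2 : ℝ → Fin 3 → ℝ) (C : Fin 7 → ℝ) (s : ℝ)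
    {η D x1 x2 x3 y1 y2 y3 : ℝ} (hη0 : 0 < η) (hη1 : η < 1 / 2)
    (hx : |x1| + |x2| + |x3| ≤ η) (hy : |y1| + |y2| + |y3| ≤ η)
    (hD : |x1 - y1| + |x2 - y2| + |x3 - y3| ≤ D) :
    |Fnl L1 L2 C s x1 x2 x3 - Fnl L1 L2 C s y1 y2 y3|
      ≤ D * (∑ i, |L1 s i|) + 2 * η * D * (∑ i, |L2 s i|) + 2 * η * D * ∑ i, |C i| := by
  obtain ⟨h12, h13, h11, h22, h111, h112, h1111⟩ := abs_monomial_diffs_le hη0 hη1 hx hy hD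
  have a1 := abs_nonneg (x1 - y1)
  have a2 := abs_nonneg (x2 - y2)
  have a3 := abs_nonneg (x3 - y3)
  have term : ∀ (a : ℝ) {b B : ℝ}, |b| ≤ B → |a * b| ≤ |a| * B := fun a b B h => by
    rw [abs_mul]
    exact mul_le_mul_of_nonneg_left h (abs_nonneg a)
  have hsplit : Fnl L1 L2 C s x1 x2 x3 - Fnl L1 L2 C s y1 y2 y3 =
      L1 s 0 * (x1 - y1) + L1 s 1 * (x2 - y2) + L1 s 2 * (x3 - y3)
      + L2 s 0 * (x1 * x2 - y1 * y2) + L2 s 1 * (x1 ^ 2 - y1 ^ 2) + L2 s 2 * (x1 ^ 3 - y1 ^ 3)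
      + C 0 * (x2 ^ 2 - y2 ^ 2) + C 1 * (x1 * x2 - y1 * y2) + C 2 * (x1 * x3 - y1 * y3)
      + C 3 * (x1 ^ 2 - y1 ^ 2) + C 4 * (x1 ^ 2 * x2 - y1 ^ 2 * y2) + C 5 * (x1 ^ 3 - y1 ^ 3)
      + C 6 * (x1 ^ 4 - y1 ^ 4) := by
    simp only [Fnl]
    ring
  rw [hsplit]
  simp only [Fin.sum_univ_three, Fin.sum_univ_seven]
  have := abs_le.1 (term (L1 s 0) (show |x1 - y1| ≤ D by linarith))
  have := abs_le.1 (term (L1 s 1) (show |x2 - y2| ≤ D by linarith))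
  have := abs_le.1 (term (L1 s 2) (show |x3 - y3| ≤ D by linarith))
  have := abs_le.1 (term (L2 s 0) h12)
  have := abs_le.1 (term (L2 s 1) h11)
  have := abs_le.1 (term (L2 s 2) h111)
  have := abs_le.1 (term (C 0) h22)
  have := abs_le.1 (term (C 1) h12)
  have := abs_le.1 (term (C 2) h13)
  have := abs_le.1 (term (C 3) h11)
  have := abs_le.1 (term (C 4) h112)
  have := abs_le.1 (term (C 5) h111)
  have := abs_le.1 (term (C 6) h1111)
  rw [abs_le]
  constructor <;> linarith

lemma continuousOn_Fnl {L1 L2 : ℝ → Fin 3 → ℝ} (C : Fin 7 → ℝ) {v : ℝ → ℝ} {a : ℝ}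
    (hL1 : ContinuousOn L1 (Ici a)) (hL2 : ContinuousOn L2 (Ici a))
    (hv : ContDiffOn ℝ 2 v (Ici a)) :
    ContinuousOn (fun s => Fnl L1 L2 C s (v s) (derivWithin v (Ici a) s)
      (derivWithin (derivWithin v (Ici a)) (Ici a) s)) (Ici a) := by
  have h0 := hv.continuousOn
  have hd : ContDiffOn ℝ 1 (derivWithin v (Ici a)) (Ici a) :=
    hv.derivWithin (uniqueDiffOn_Ici a) (by norm_num)
  have h1 := hd.continuousOn
  have h2 := hd.continuousOn_derivWithin (uniqueDiffOn_Ici a) le_rfl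
  have l1 := continuousOn_pi.1 hL1
  have l2 := continuousOn_pi.1 hL2
  have l10 := l1 0
  have l11 := l1 1
  have l12 := l1 2
  have l20 := l2 0
  have l21 := l2 1
  have l22 := l2 2
  unfold Fnl
  fun_prop

/-- the contraction-type estimate
`Σ_{j≤2} |(Tz)^{(j)}(t) − (Tw)^{(j)}(t)| ≤ ‖z−w‖₀ (L(‖Λ₁‖₁)(t) + 2ηL(‖Λ₂‖₁)(t) + 2η‖C‖₁L(1)(t))`
for the fixed point operator `T` on the ball of radius `η < 1/2`. -/
theorem stmt_15 (t0 g1 g2 g3 η : ℝ) (L1 L2 : ℝ → Fin 3 → ℝ) (C : Fin 7 → ℝ)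
    (Om : ℝ → ℝ) (z w : ℝ → ℝ) (K : ℝ → ℝ → ℝ) (T : (ℝ → ℝ) → ℝ → ℝ)
    (hg1 : g1 < 0) (hg2 : g2 < 0) (hg3 : g3 < 0)
    (h12 : g1 ≠ g2) (h13 : g1 ≠ g3) (h23 : g2 ≠ g3)
    (hL1c : ContinuousOn L1 (Ici t0)) (hL2c : ContinuousOn L2 (Ici t0))
    (hOmc : ContinuousOn Om (Ici t0))
    (hK : K = fun t s => |g1Green g1 g2 g3 t s|
      + |deriv (fun u => g1Green g1 g2 g3 u s) t|
      + |deriv (deriv (fun u => g1Green g1 g2 g3 u s)) t|)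
    (hfinL1 : ∀ t, IntegrableOn (fun s => K t s * ∑ i, |L1 s i|) (Ioi t0))
    (hfinL2 : ∀ t, IntegrableOn (fun s => K t s * ∑ i, |L2 s i|) (Ioi t0))
    (hfin1 : ∀ t, IntegrableOn (fun s => K t s) (Ioi t0))
    (hT : T = fun v t =>
      ∫ s in Ioi t0,
        g1Green g1 g2 g3 t s *
          (Om s + Fnl L1 L2 C s (v s) (derivWithin v (Ici t0) s)
            (derivWithin (derivWithin v (Ici t0)) (Ici t0) s)))
    (hη0 : 0 < η) (hη1 : η < 1 / 2)
    (hz : ContDiffOn ℝ 2 z (Ici t0))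
    (hzb : ∀ t ∈ Ici t0,
      |z t| + |derivWithin z (Ici t0) t|
        + |derivWithin (derivWithin z (Ici t0)) (Ici t0) t| ≤ η)
    (hw : ContDiffOn ℝ 2 w (Ici t0))
    (hwb : ∀ t ∈ Ici t0,
      |w t| + |derivWithin w (Ici t0) t|
        + |derivWithin (derivWithin w (Ici t0)) (Ici t0) t| ≤ η) :
    ∀ t, t0 ≤ t →
      |T z t - T w t| + |deriv (T z) t - deriv (T w) t|
          + |deriv (deriv (T z)) t - deriv (deriv (T w)) t|
        ≤ (⨆ u : Ici t0,
            (|z u.1 - w u.1|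
              + |derivWithin z (Ici t0) u.1 - derivWithin w (Ici t0) u.1|
              + |derivWithin (derivWithin z (Ici t0)) (Ici t0) u.1
                  - derivWithin (derivWithin w (Ici t0)) (Ici t0) u.1|)) *
          ((∫ s in Ioi t0, K t s * ∑ i, |L1 s i|)
            + 2 * η * (∫ s in Ioi t0, K t s * ∑ i, |L2 s i|)
            + 2 * η * (∑ i, |C i|) * ∫ s in Ioi t0, K t s) := by
  intro t _
  set r : Fin 3 → ℝ := ![-g1, -g2, -g3] with hr_def
  set c : Fin 3 → ℝ := fun i =>
    ((g2 - g1) * (g3 - g2) * (g3 - g1))⁻¹ * ![g3 - g2, g1 - g3, g2 - g1] i with hc_def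
  have hG : ∀ t s, g1Green g1 g2 g3 t s = truncExpSum c r (t - s) :=
    g1Green_eq_truncExpSum g1 g2 g3
  have hrpos : ∀ i, 0 < r i := by
    intro i
    fin_cases i <;> simp [hr_def, hg1, hg2, hg3]
  have hrinj : Function.Injective r := by
    intro i j hij
    fin_cases i <;> fin_cases j <;> simp_all [eq_comm]
  have hcne : ∀ i, c i ≠ 0 := by
    have d2 := sub_ne_zero.2 h13
    have d4 := sub_ne_zero.2 h12.symm
    have d5 := sub_ne_zero.2 h13.symm
    have d6 := sub_ne_zero.2 h23.symm
    intro i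
    fin_cases i <;> simp [hc_def, d2, d4, d5, d6]
  have hc0 : ∑ i, c i = 0 := by
    simp only [hc_def, Fin.sum_univ_three, Matrix.cons_val]
    ring
  have hc1 : ∑ i, (c * r) i = 0 := by
    simp only [hc_def, hr_def, Fin.sum_univ_three, Pi.mul_apply, Matrix.cons_val]
    ring
  obtain ⟨i₀, hi₀⟩ := Finite.exists_min r
  have hlt : ∀ i, i ≠ i₀ → r i₀ < r i := fun i hi =>
    lt_of_le_of_ne (hi₀ i) fun h => hi (hrinj h.symm)
  have hKG : ∀ t s, s ≠ t → K t s = |truncExpSum c r (t - s)|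
      + |truncExpSum (c * r) r (t - s)| + |truncExpSum (c * r * r) r (t - s)| := by
    intro t s hst
    have hd : ∀ c' : Fin 3 → ℝ, ∀ u, u ≠ s →
        deriv (fun u => truncExpSum c' r (u - s)) u = truncExpSum (c' * r) r (u - s) :=
      fun c' u hu =>
        ((hasDerivAt_truncExpSum c' r (sub_ne_zero.2 hu)).comp_sub_const u s).deriv
    have hev : deriv (fun u => truncExpSum c r (u - s)) =ᶠ[𝓝 t]
        fun u => truncExpSum (c * r) r (u - s) := by
      filter_upwards [isOpen_ne.mem_nhds hst.symm] with u hu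
      exact hd c u hu
    simp only [hK, hG]
    rw [hev.deriv_eq, hd _ t hst.symm, hd _ t hst.symm]
  set N : ℝ → ℝ := fun u => |z u - w u|
    + |derivWithin z (Ici t0) u - derivWithin w (Ici t0) u|
    + |derivWithin (derivWithin z (Ici t0)) (Ici t0) u
        - derivWithin (derivWithin w (Ici t0)) (Ici t0) u| with hN
  set D : ℝ := ⨆ u : Ici t0, N u.1 with hD
  have hND : ∀ u ∈ Ici t0, N u ≤ D := by
    intro u hu
    refine le_ciSup (f := fun u : Ici t0 => N u.1) ⟨η + η, ?_⟩ ⟨u, hu⟩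
    rintro _ ⟨⟨v, hv⟩, rfl⟩
    have h1 := hzb v hv
    have h2 := hwb v hv
    simp only [hN]
    linarith [abs_sub (z v) (w v),
      abs_sub (derivWithin z (Ici t0) v) (derivWithin w (Ici t0) v),
      abs_sub (derivWithin (derivWithin z (Ici t0)) (Ici t0) v)
        (derivWithin (derivWithin w (Ici t0)) (Ici t0) v)]
  have hD0 : 0 ≤ D := le_trans (by positivity) (hND t0 self_mem_Ici)
  set Ez : ℝ → ℝ := fun s => Om s + Fnl L1 L2 C s (z s) (derivWithin z (Ici t0) s)
    (derivWithin (derivWithin z (Ici t0)) (Ici t0) s) with hEz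
  set Ew : ℝ → ℝ := fun s => Om s + Fnl L1 L2 C s (w s) (derivWithin w (Ici t0) s)
    (derivWithin (derivWithin w (Ici t0)) (Ici t0) s) with hEw
  have hEzc : ContinuousOn Ez (Ici t0) := hOmc.add (continuousOn_Fnl C hL1c hL2c hz)
  have hEwc : ContinuousOn Ew (Ici t0) := hOmc.add (continuousOn_Fnl C hL1c hL2c hw)
  have hmeas : ∀ {E : ℝ → ℝ}, ContinuousOn E (Ici t0) →
      AEStronglyMeasurable E (volume.restrict (Ioi t0)) := fun h =>
    (h.mono Ioi_subset_Ici_self).aestronglyMeasurable measurableSet_Ioi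
  have hTz : T z = fun t => ∫ s in Ioi t0, truncExpSum c r (t - s) * Ez s := by
    simp only [hT, hG, hEz]
  have hTw : T w = fun t => ∫ s in Ioi t0, truncExpSum c r (t - s) * Ew s := by
    simp only [hT, hG, hEw]
  have hdiff : ∀ s ∈ Ioi t0, |Ez s - Ew s| ≤
      D * (∑ i, |L1 s i|) + 2 * η * D * (∑ i, |L2 s i|) + 2 * η * D * ∑ i, |C i| := by
    intro s hs
    have hs' : s ∈ Ici t0 := Ioi_subset_Ici_self hs
    simp only [hEz, hEw, add_sub_add_left_eq_sub]
    exact abs_Fnl_sub_le L1 L2 C s hη0 hη1 (hzb s hs') (hwb s hs') (hND s hs')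
  set B : ℝ → ℝ := fun s => D * (K t s * ∑ i, |L1 s i|) + 2 * η * D * (K t s * ∑ i, |L2 s i|)
    + 2 * η * D * (∑ i, |C i|) * K t s with hB
  have hi1 := (hfinL1 t).const_mul D
  have hi2 := (hfinL2 t).const_mul (2 * η * D)
  have hi3 := (hfin1 t).const_mul (2 * η * D * ∑ i, |C i|)
  have hi12 : Integrable (fun s => D * (K t s * ∑ i, |L1 s i|)
      + 2 * η * D * (K t s * ∑ i, |L2 s i|)) (volume.restrict (Ioi t0)) := hi1.add hi2
  have hBint : IntegrableOn B (Ioi t0) := hi12.add hi3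
  have hBeq : ∫ s in Ioi t0, B s = D * ((∫ s in Ioi t0, K t s * ∑ i, |L1 s i|)
      + 2 * η * (∫ s in Ioi t0, K t s * ∑ i, |L2 s i|)
      + 2 * η * (∑ i, |C i|) * ∫ s in Ioi t0, K t s) := by
    simp only [hB]
    rw [integral_add hi12 hi3, integral_add hi1 hi2, integral_const_mul,
      integral_const_mul, integral_const_mul]
    ring
  have hbound : ∀ᵐ s ∂(volume.restrict (Ioi t0)),
      |truncExpSum c r (t - s) * (Ez s - Ew s)|
        + |truncExpSum (c * r) r (t - s) * (Ez s - Ew s)|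
        + |truncExpSum (c * r * r) r (t - s) * (Ez s - Ew s)| ≤ B s := by
    filter_upwards [ae_restrict_mem measurableSet_Ioi,
      ae_restrict_of_ae (Measure.ae_ne volume t)] with s hs hst
    rw [abs_mul, abs_mul, abs_mul, ← add_mul, ← add_mul, ← hKG t s hst]
    have hK0 : 0 ≤ K t s := by
      rw [hKG t s hst]
      positivity
    refine (mul_le_mul_of_nonneg_left (hdiff s hs) hK0).trans_eq ?_
    simp only [hB]
    ring
  have hdint : IntegrableOn (fun s => Real.exp (-(r i₀ * s)) * (Ez s - Ew s)) (Ioi t0) := by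
    refine integrableOn_exp_mul_of_truncExpSum_mul hlt (hcne i₀) (hEzc.sub hEwc) t ?_
    refine Integrable.mono' hBint ?_ ?_
    · exact (((measurable_truncExpSum c r).comp
        (measurable_const.sub measurable_id)).aestronglyMeasurable).mul
          (hmeas (hEzc.sub hEwc))
    · filter_upwards [hbound] with s hs
      rw [Real.norm_eq_abs]
      linarith [abs_nonneg (truncExpSum (c * r) r (t - s) * (Ez s - Ew s)),
        abs_nonneg (truncExpSum (c * r * r) r (t - s) * (Ez s - Ew s))]
  have hd : ∀ c' : Fin 3 → ℝ,
      IntegrableOn (fun s => truncExpSum c' r (t - s) * (Ez s - Ew s)) (Ioi t0) := fun c' =>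
    integrable_truncExpSum_mul hi₀ (hmeas (hEzc.sub hEwc)) hdint t
  have hd01 : Integrable (fun s => |truncExpSum c r (t - s) * (Ez s - Ew s)|
      + |truncExpSum (c * r) r (t - s) * (Ez s - Ew s)|) (volume.restrict (Ioi t0)) :=
    (hd c).abs.add (hd (c * r)).abs
  have hsum : |∫ s in Ioi t0, truncExpSum c r (t - s) * (Ez s - Ew s)|
      + |∫ s in Ioi t0, truncExpSum (c * r) r (t - s) * (Ez s - Ew s)|
      + |∫ s in Ioi t0, truncExpSum (c * r * r) r (t - s) * (Ez s - Ew s)|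
      ≤ ∫ s in Ioi t0, B s := by
    calc _ ≤ (∫ s in Ioi t0, |truncExpSum c r (t - s) * (Ez s - Ew s)|)
          + (∫ s in Ioi t0, |truncExpSum (c * r) r (t - s) * (Ez s - Ew s)|)
          + ∫ s in Ioi t0, |truncExpSum (c * r * r) r (t - s) * (Ez s - Ew s)| := by
          gcongr <;> exact abs_integral_le_integral_abs
      _ = ∫ s in Ioi t0, (|truncExpSum c r (t - s) * (Ez s - Ew s)|
          + |truncExpSum (c * r) r (t - s) * (Ez s - Ew s)|
          + |truncExpSum (c * r * r) r (t - s) * (Ez s - Ew s)|) := by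
          rw [integral_add hd01 (hd (c * r * r)).abs,
            integral_add (hd c).abs (hd (c * r)).abs]
      _ ≤ _ := integral_mono_ae (hd01.add (hd (c * r * r)).abs)
          hBint hbound
  rw [← hBeq]
  by_cases hzint : IntegrableOn (fun s => Real.exp (-(r i₀ * s)) * Ez s) (Ioi t0)
  · have hwint : IntegrableOn (fun s => Real.exp (-(r i₀ * s)) * Ew s) (Ioi t0) := by
      refine (hzint.sub hdint).congr (Eventually.of_forall fun s => ?_)
      simp only [Pi.sub_apply]
      ring
    have hsub : ∀ c' : Fin 3 → ℝ, (∫ s in Ioi t0, truncExpSum c' r (t - s) * Ez s)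
        - (∫ s in Ioi t0, truncExpSum c' r (t - s) * Ew s)
        = ∫ s in Ioi t0, truncExpSum c' r (t - s) * (Ez s - Ew s) := by
      intro c'
      rw [← integral_sub (integrable_truncExpSum_mul hi₀ (hmeas hEzc) hzint t)
        (integrable_truncExpSum_mul hi₀ (hmeas hEwc) hwint t)]
      simp only [mul_sub]
    have hderiv : ∀ {E : ℝ → ℝ}, ContinuousOn E (Ici t0) →
        IntegrableOn (fun s => Real.exp (-(r i₀ * s)) * E s) (Ioi t0) →
        ∀ c' : Fin 3 → ℝ, ∑ i, c' i = 0 →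
        deriv (fun t => ∫ s in Ioi t0, truncExpSum c' r (t - s) * E s)
          = fun t => ∫ s in Ioi t0, truncExpSum (c' * r) r (t - s) * E s :=
      fun hE hEint c' hc' => funext fun u =>
        (hasDerivAt_integral_truncExpSum (hrpos i₀).le hi₀ hc' (hmeas hE) hEint u).deriv
    rw [hTz, hTw, hderiv hEzc hzint c hc0, hderiv hEwc hwint c hc0, hderiv hEzc hzint _ hc1,
      hderiv hEwc hwint _ hc1, hsub, hsub, hsub]
    exact hsum
  · have hwint : ¬ IntegrableOn (fun s => Real.exp (-(r i₀ * s)) * Ew s) (Ioi t0) := by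
      intro h
      refine hzint ((h.add hdint).congr (Eventually.of_forall fun s => ?_))
      simp only [Pi.add_apply]
      ring
    have hzero : ∀ {E : ℝ → ℝ}, ContinuousOn E (Ici t0) →
        ¬ IntegrableOn (fun s => Real.exp (-(r i₀ * s)) * E s) (Ioi t0) →
        (fun t => ∫ s in Ioi t0, truncExpSum c r (t - s) * E s) = fun _ => 0 :=
      fun hE hEint => funext fun u => integral_undef fun h =>
        hEint (integrableOn_exp_mul_of_truncExpSum_mul hlt (hcne i₀) hE u h)
    rw [hTz, hTw, hzero hEzc hzint, hzero hEwc hwint]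
    simp only [sub_self, abs_zero, add_zero]
    exact le_trans (by positivity) hsum
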